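/- (Braid relation with the thick strand in the middle.) In R_{m+2}(Q̄_{C̃}), for all i, j ∈ I, with E'' := e((i,μ̄,j)) times the copy of e_{λ_k} on strand positions 2,…,m+1: (ψ_1⋯ψ_m) ψ_{m+1} (ψ_m⋯ψ_1) E'' − (ψ_{m+1}⋯ψ_2) ψ_1 (ψ_2⋯ψ_{m+1}) E'' = δ_{i,j} Σ_{a+b+c = λ_k^{(i)}−1, a,b,c ≥ 0} (−1)^c x_1^{a} x_{m+2}^{b} E_c^{(i)}[2,…,m+1] E'', where δ_{i,j} is the Kronecker delta, E_c^{(i)}[2,…,m+1] denotes the c-th elementary symmetric polynomial in the variables x_l for l in the i-th block of the thick strand occupying positions 2,…,m+1 (E_0 = 1), and (ψ_p⋯ψ_q) denotes the ordered product ψ_pψ_{p+1}⋯ψ_q when p ≤ q and ψ_pψ_{p−1}⋯ψ_q when p ≥ q. -/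

import Mathlib

open Classical
open scoped BigOperators

noncomputable section

/-- A Cartan datum on a finite index set `I`: a symmetric bilinear form with
`i·i ∈ 2ℤ_{>0}` and `2(i·j)/(i·i)` a nonpositive integer for `i ≠ j`. -/
structure CartanDatum (I : Type) [Fintype I] where
  form : I → I → ℤ
  symm : ∀ i j, form i j = form j i
  diag_even : ∀ i, Even (form i i)
  diag_pos : ∀ i, 0 < form i i
  off_dvd : ∀ i j, i ≠ j → form i i ∣ 2 * form i j
  off_nonpos : ∀ i j, i ≠ j → 2 * form i j ≤ 0

/-- The bilinear form of the extended Cartan datum on `Ĩ = I ⊔ Ī`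
(`Sum.inl` is `I`, `Sum.inr` is `Ī`). -/
def extForm {I : Type} [Fintype I] (C : CartanDatum I) : I ⊕ I → I ⊕ I → ℤ
  | Sum.inl i, Sum.inl j => C.form i j
  | Sum.inl i, Sum.inr j => if j = i then -(C.form i i / 2) else 0
  | Sum.inr i, Sum.inl j => if j = i then -(C.form i i / 2) else 0
  | Sum.inr i, Sum.inr j => if i = j then C.form i i else 0

/-- Generators of the KLR algebra on `n` strands labelled by `J`:
idempotents `e 𝐢`, dots `x j`, crossings `psi j` (crossing strands `j, j+1`, 0-indexed). -/
inductive KLRGen (J : Type) (n : ℕ) : Type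
  | e : (Fin n → J) → KLRGen J n
  | x : Fin n → KLRGen J n
  | psi : Fin (n - 1) → KLRGen J n

/-- The left strand position of the crossing `ψ_j`. -/
def lpos {n : ℕ} (j : Fin (n - 1)) : Fin n := Fin.castLE (n.sub_le 1) j

/-- The right strand position of the crossing `ψ_j`. -/
def rpos {n : ℕ} (j : Fin (n - 1)) : Fin n :=
  ⟨j.val + 1, by have := j.isLt; omega⟩

/-- The generator `e(𝐢)` of the free algebra. -/
def Ef (𝕜 : Type) [Field 𝕜] (J : Type) (n : ℕ) (i : Fin n → J) :
    FreeAlgebra 𝕜 (KLRGen J n) :=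
  FreeAlgebra.ι 𝕜 (KLRGen.e i)

/-- The generator `x_j` of the free algebra. -/
def Xf (𝕜 : Type) [Field 𝕜] (J : Type) (n : ℕ) (j : Fin n) :
    FreeAlgebra 𝕜 (KLRGen J n) :=
  FreeAlgebra.ι 𝕜 (KLRGen.x j)

/-- The generator `ψ_j` of the free algebra. -/
def Pf (𝕜 : Type) [Field 𝕜] (J : Type) (n : ℕ) (j : Fin (n - 1)) :
    FreeAlgebra 𝕜 (KLRGen J n) :=
  FreeAlgebra.ι 𝕜 (KLRGen.psi j)

/-- The Cartan integer `c(a,b) = 2(a·b)/(a·a)`. -/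
def cB {J : Type} (B : J → J → ℤ) (a b : J) : ℤ := 2 * B a b / B a a

/-- A bound such that any `p` with `s^{pq}(a,b) ≠ 0` satisfies `p < sBound B a b`. -/
def sBound {J : Type} (B : J → J → ℤ) (a b : J) : ℕ := (-(B a b)).toNat + 1

/-- The term `Σ_{p,q} s^{pq}(a,b) x_j^p x_{j'}^q`. -/
def psiSqS (𝕜 : Type) [Field 𝕜] (J : Type) (n : ℕ) (B : J → J → ℤ)
    (s : J → J → ℕ → ℕ → 𝕜) (a b : J) (j j' : Fin n) :
    FreeAlgebra 𝕜 (KLRGen J n) :=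
  ∑ p ∈ Finset.range (sBound B a b), ∑ q ∈ Finset.range (sBound B a b),
    s a b p q • (Xf 𝕜 J n j ^ p * Xf 𝕜 J n j' ^ q)

/-- The defining relations of the KLR algebra `R_n` associated with the form `B`
and scalar parameters `t`, `r`, `s`. -/
inductive KLRRel (𝕜 : Type) [Field 𝕜] (J : Type) [Fintype J] (n : ℕ)
    (B : J → J → ℤ) (t : J → J → 𝕜) (r : J → 𝕜) (s : J → J → ℕ → ℕ → 𝕜) :
    FreeAlgebra 𝕜 (KLRGen J n) → FreeAlgebra 𝕜 (KLRGen J n) → Prop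
  | ee (i j : Fin n → J) :
      KLRRel 𝕜 J n B t r s (Ef 𝕜 J n i * Ef 𝕜 J n j)
        (if i = j then Ef 𝕜 J n i else 0)
  | esum :
      KLRRel 𝕜 J n B t r s (∑ i : Fin n → J, Ef 𝕜 J n i) 1
  | xe (j : Fin n) (i : Fin n → J) :
      KLRRel 𝕜 J n B t r s (Xf 𝕜 J n j * Ef 𝕜 J n i) (Ef 𝕜 J n i * Xf 𝕜 J n j)
  | psie (j : Fin (n - 1)) (i : Fin n → J) :
      KLRRel 𝕜 J n B t r s (Pf 𝕜 J n j * Ef 𝕜 J n i)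
        (Ef 𝕜 J n (i ∘ Equiv.swap (lpos j) (rpos j)) * Pf 𝕜 J n j)
  | xx (j k : Fin n) :
      KLRRel 𝕜 J n B t r s (Xf 𝕜 J n j * Xf 𝕜 J n k) (Xf 𝕜 J n k * Xf 𝕜 J n j)
  | psix (j : Fin (n - 1)) (k : Fin n) (h1 : k ≠ lpos j) (h2 : k ≠ rpos j) :
      KLRRel 𝕜 J n B t r s (Pf 𝕜 J n j * Xf 𝕜 J n k) (Xf 𝕜 J n k * Pf 𝕜 J n j)
  | psipsi (j k : Fin (n - 1)) (h : (j : ℕ) + 1 < (k : ℕ)) :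
      KLRRel 𝕜 J n B t r s (Pf 𝕜 J n j * Pf 𝕜 J n k) (Pf 𝕜 J n k * Pf 𝕜 J n j)
  | dot1 (j : Fin (n - 1)) (i : Fin n → J) :
      KLRRel 𝕜 J n B t r s
        (Xf 𝕜 J n (lpos j) * Pf 𝕜 J n j * Ef 𝕜 J n i
          - Pf 𝕜 J n j * Xf 𝕜 J n (rpos j) * Ef 𝕜 J n i)
        (if i (lpos j) = i (rpos j) then r (i (lpos j)) • Ef 𝕜 J n i else 0)
  | dot2 (j : Fin (n - 1)) (i : Fin n → J) :
      KLRRel 𝕜 J n B t r s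
        (Pf 𝕜 J n j * Xf 𝕜 J n (lpos j) * Ef 𝕜 J n i
          - Xf 𝕜 J n (rpos j) * Pf 𝕜 J n j * Ef 𝕜 J n i)
        (if i (lpos j) = i (rpos j) then r (i (lpos j)) • Ef 𝕜 J n i else 0)
  | psisq (j : Fin (n - 1)) (i : Fin n → J) :
      KLRRel 𝕜 J n B t r s (Pf 𝕜 J n j * Pf 𝕜 J n j * Ef 𝕜 J n i)
        (if i (lpos j) = i (rpos j) then 0
         else if B (i (lpos j)) (i (rpos j)) = 0 then
           t (i (lpos j)) (i (rpos j)) • Ef 𝕜 J n i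
         else
           (t (i (lpos j)) (i (rpos j)) •
              (Xf 𝕜 J n (lpos j) ^ (-(cB B (i (lpos j)) (i (rpos j)))).toNat)
            + t (i (rpos j)) (i (lpos j)) •
              (Xf 𝕜 J n (rpos j) ^ (-(cB B (i (rpos j)) (i (lpos j)))).toNat)
            + psiSqS 𝕜 J n B s (i (lpos j)) (i (rpos j)) (lpos j) (rpos j))
           * Ef 𝕜 J n i)
  | braid (j k : Fin (n - 1)) (h : (j : ℕ) + 1 = (k : ℕ)) (i : Fin n → J) :
      KLRRel 𝕜 J n B t r s
        (Pf 𝕜 J n j * Pf 𝕜 J n k * Pf 𝕜 J n j * Ef 𝕜 J n i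
          - Pf 𝕜 J n k * Pf 𝕜 J n j * Pf 𝕜 J n k * Ef 𝕜 J n i)
        (if i (lpos j) = i (rpos k) ∧ cB B (i (lpos j)) (i (rpos j)) + 1 ≤ 0 then
          (r (i (lpos j)) * t (i (lpos j)) (i (rpos j))) •
            (∑ d ∈ Finset.range ((-(cB B (i (lpos j)) (i (rpos j))) - 1).toNat + 1),
              Xf 𝕜 J n (lpos j) ^ d
                * Xf 𝕜 J n (rpos k) ^ ((-(cB B (i (lpos j)) (i (rpos j))) - 1).toNat - d)
                * Ef 𝕜 J n i)
          + r (i (lpos j)) •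
            (∑ p ∈ Finset.range (sBound B (i (lpos j)) (i (rpos j))),
             ∑ q ∈ Finset.range (sBound B (i (lpos j)) (i (rpos j))),
              s (i (lpos j)) (i (rpos j)) p q •
                ∑ k1 ∈ Finset.range p,
                  Xf 𝕜 J n (lpos j) ^ k1 * Xf 𝕜 J n (rpos j) ^ q
                    * Xf 𝕜 J n (rpos k) ^ (p - 1 - k1) * Ef 𝕜 J n i)
         else 0)

/-- The KLR algebra `R_n` on `n` strands. -/
abbrev KLRAlg (𝕜 : Type) [Field 𝕜] (J : Type) [Fintype J] (n : ℕ)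
    (B : J → J → ℤ) (t : J → J → 𝕜) (r : J → 𝕜) (s : J → J → ℕ → ℕ → 𝕜) :=
  RingQuot (KLRRel 𝕜 J n B t r s)

/-- The canonical map from the free algebra to the KLR algebra. -/
def klrMk (𝕜 : Type) [Field 𝕜] (J : Type) [Fintype J] (n : ℕ)
    (B : J → J → ℤ) (t : J → J → 𝕜) (r : J → 𝕜) (s : J → J → ℕ → ℕ → 𝕜) :
    FreeAlgebra 𝕜 (KLRGen J n) →ₐ[𝕜] KLRAlg 𝕜 J n B t r s :=
  RingQuot.mkAlgHom 𝕜 (KLRRel 𝕜 J n B t r s)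

/-- The idempotent `e(𝐢)` in the KLR algebra. -/
def eQ (𝕜 : Type) [Field 𝕜] (J : Type) [Fintype J] (n : ℕ)
    (B : J → J → ℤ) (t : J → J → 𝕜) (r : J → 𝕜) (s : J → J → ℕ → ℕ → 𝕜)
    (i : Fin n → J) : KLRAlg 𝕜 J n B t r s :=
  klrMk 𝕜 J n B t r s (Ef 𝕜 J n i)

/-- The dot `x_j` in the KLR algebra. -/
def xQ (𝕜 : Type) [Field 𝕜] (J : Type) [Fintype J] (n : ℕ)
    (B : J → J → ℤ) (t : J → J → 𝕜) (r : J → 𝕜) (s : J → J → ℕ → ℕ → 𝕜)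
    (j : Fin n) : KLRAlg 𝕜 J n B t r s :=
  klrMk 𝕜 J n B t r s (Xf 𝕜 J n j)

/-- The crossing `ψ_j` in the KLR algebra. -/
def pQ (𝕜 : Type) [Field 𝕜] (J : Type) [Fintype J] (n : ℕ)
    (B : J → J → ℤ) (t : J → J → 𝕜) (r : J → 𝕜) (s : J → J → ℕ → ℕ → 𝕜)
    (j : Fin (n - 1)) : KLRAlg 𝕜 J n B t r s :=
  klrMk 𝕜 J n B t r s (Pf 𝕜 J n j)


section Extended

/-- The list of block labels of the thick strand: the label `i` appears with
multiplicity `λ^{(i)}`, in increasing order of `i`. -/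
def blockList (N : ℕ) (lam : Fin N → ℕ) : List (Fin N) :=
  (List.finRange N).flatMap (fun i => List.replicate (lam i) i)

/-- `m = Σ_i λ^{(i)}`, the total number of dashed strands of the thick strand. -/
def mTot (N : ℕ) (lam : Fin N → ℕ) : ℕ := (blockList N lam).length

/-- The block containing the strand position `l`. -/
def blockOf (N : ℕ) (lam : Fin N → ℕ) (l : Fin (mTot N lam)) : Fin N :=
  (blockList N lam).get l

/-- `psum i = Σ_{a < i} λ^{(a)}`, the starting position of the `i`-th block. -/
def psum (N : ℕ) (lam : Fin N → ℕ) (i : Fin N) : ℕ :=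
  ∑ a : Fin N, if a.val < i.val then lam a else 0

/-- The sequence `μ̄ ∈ Ī^m` listing each `ī` with multiplicity `λ^{(i)}`, in
increasing order of `i`. -/
def mubar (N : ℕ) (lam : Fin N → ℕ) : Fin (mTot N lam) → Fin N ⊕ Fin N :=
  fun l => Sum.inr (blockOf N lam l)

/-- The standard reduced word `s_1 (s_2 s_1) ⋯ (s_{a−1} ⋯ s_1)` (0-indexed) of the
longest element `w_0` of `𝔖_a`. -/
def w0Word (a : ℕ) : List ℕ :=
  (List.range a).flatMap (fun k => (List.range k).reverse)

/-- The KLR algebra `R_n(Q̄_{C̃})` of the extended Cartan datum of `C` with the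
specialized scalar parameters: `r ≡ 1`, `s ≡ 0` and `t` as given. -/
abbrev ExtKLR (𝕜 : Type) [Field 𝕜] (N : ℕ) (C : CartanDatum (Fin N))
    (t : Fin N ⊕ Fin N → Fin N ⊕ Fin N → 𝕜) (n : ℕ) :=
  KLRAlg 𝕜 (Fin N ⊕ Fin N) n (extForm C) t (fun _ => 1) (fun _ _ _ _ => 0)

/-- The dot `x_l` (0-indexed position `l`, junk value `1` if `l ≥ n`). -/
def Xn (𝕜 : Type) [Field 𝕜] (N : ℕ) (C : CartanDatum (Fin N))
    (t : Fin N ⊕ Fin N → Fin N ⊕ Fin N → 𝕜) (n : ℕ) (l : ℕ) :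
    ExtKLR 𝕜 N C t n :=
  if h : l < n then
    xQ 𝕜 (Fin N ⊕ Fin N) n (extForm C) t (fun _ => 1) (fun _ _ _ _ => 0) ⟨l, h⟩
  else 1

/-- The crossing `ψ_l` of the strands at 0-indexed positions `l, l+1`
(junk value `1` if `l ≥ n − 1`). -/
def Pn (𝕜 : Type) [Field 𝕜] (N : ℕ) (C : CartanDatum (Fin N))
    (t : Fin N ⊕ Fin N → Fin N ⊕ Fin N → 𝕜) (n : ℕ) (l : ℕ) :
    ExtKLR 𝕜 N C t n :=
  if h : l < n - 1 then
    pQ 𝕜 (Fin N ⊕ Fin N) n (extForm C) t (fun _ => 1) (fun _ _ _ _ => 0) ⟨l, h⟩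
  else 1

/-- The idempotent `e(𝐢)` of `R_n(Q̄_{C̃})`. -/
def eS (𝕜 : Type) [Field 𝕜] (N : ℕ) (C : CartanDatum (Fin N))
    (t : Fin N ⊕ Fin N → Fin N ⊕ Fin N → 𝕜) (n : ℕ)
    (i : Fin n → Fin N ⊕ Fin N) : ExtKLR 𝕜 N C t n :=
  eQ 𝕜 (Fin N ⊕ Fin N) n (extForm C) t (fun _ => 1) (fun _ _ _ _ => 0) i

/-- The nilHecke idempotent `e_a = x_1^{a−1} ⋯ x_{a−1} ψ_{w_0}` written in the
generators attached to the `a` consecutive strand positions `o, o+1, …, o+a−1`. -/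
def enAt (𝕜 : Type) [Field 𝕜] (N : ℕ) (C : CartanDatum (Fin N))
    (t : Fin N ⊕ Fin N → Fin N ⊕ Fin N → 𝕜) (n o a : ℕ) :
    ExtKLR 𝕜 N C t n :=
  (((List.range a).map (fun d => Xn 𝕜 N C t n (o + d) ^ (a - 1 - d))).prod) *
  (((w0Word a).map (fun l => Pn 𝕜 N C t n (o + l))).prod)

/-- The product `Π_{i ∈ I} e_{λ^{(i)}}` of nilHecke idempotents, the `i`-th one
written in the generators of the `i`-th block of strand positions, the thick
strand occupying the positions `o, o+1, …, o+m−1`. -/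
def nilProd (𝕜 : Type) [Field 𝕜] (N : ℕ) (C : CartanDatum (Fin N))
    (t : Fin N ⊕ Fin N → Fin N ⊕ Fin N → 𝕜) (lam : Fin N → ℕ) (n o : ℕ) :
    ExtKLR 𝕜 N C t n :=
  ((List.finRange N).map (fun i => enAt 𝕜 N C t n (o + psum N lam i) (lam i))).prod

/-- The thick idempotent `e_{λ} = e(μ̄) Π_i e_{λ^{(i)}} ∈ R_m(Q̄_{C̃})`. -/
def thickE (𝕜 : Type) [Field 𝕜] (N : ℕ) (C : CartanDatum (Fin N))
    (t : Fin N ⊕ Fin N → Fin N ⊕ Fin N → 𝕜) (lam : Fin N → ℕ) :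
    ExtKLR 𝕜 N C t (mTot N lam) :=
  eS 𝕜 N C t (mTot N lam) (mubar N lam) * nilProd 𝕜 N C t lam (mTot N lam) 0

/-- The `d`-th elementary symmetric polynomial in the dots `x_l`, `l ∈ S`. -/
def esymAt (𝕜 : Type) [Field 𝕜] (N : ℕ) (C : CartanDatum (Fin N))
    (t : Fin N ⊕ Fin N → Fin N ⊕ Fin N → 𝕜) (n d : ℕ) (S : Finset ℕ) :
    ExtKLR 𝕜 N C t n :=
  ∑ T ∈ S.powersetCard d, ((T.sort (· ≤ ·)).map (Xn 𝕜 N C t n)).prod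

/-- The set of strand positions of the `i`-th block of the thick strand, when the
thick strand occupies the positions `o, o+1, …, o+m−1`. -/
def blkSet (N : ℕ) (lam : Fin N → ℕ) (o : ℕ) (i : Fin N) : Finset ℕ :=
  Finset.Ico (o + psum N lam i) (o + psum N lam i + lam i)

end Extended


section MiddleThick

variable (𝕜 : Type) [Field 𝕜] (N : ℕ) (C : CartanDatum (Fin N))
  (t : Fin N ⊕ Fin N → Fin N ⊕ Fin N → 𝕜) (lam : Fin N → ℕ)

/-- The idempotent `E'' = e((i,μ̄,j))·e_{λ_k}` of `R_{m+2}(Q̄_{C̃})`, the thick strand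
occupying positions `2,…,m+1`. -/
def Emid (i j : Fin N) : ExtKLR 𝕜 N C t (mTot N lam + 2) :=
  eS 𝕜 N C t (mTot N lam + 2)
      (Fin.snoc (Fin.cons (Sum.inl i) (mubar N lam)) (Sum.inl j)) *
    nilProd 𝕜 N C t lam (mTot N lam + 2) 1

/-- `ψ_1 ψ_2 ⋯ ψ_m` in `R_{m+2}(Q̄_{C̃})`. -/
def psiUp2 : ExtKLR 𝕜 N C t (mTot N lam + 2) :=
  ((List.range (mTot N lam)).map (Pn 𝕜 N C t (mTot N lam + 2))).prod

/-- `ψ_2 ψ_3 ⋯ ψ_{m+1}` in `R_{m+2}(Q̄_{C̃})`. -/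
def psiUp2' : ExtKLR 𝕜 N C t (mTot N lam + 2) :=
  ((List.range (mTot N lam)).map (fun l => Pn 𝕜 N C t (mTot N lam + 2) (l + 1))).prod

/-- `ψ_m ψ_{m−1} ⋯ ψ_1` in `R_{m+2}(Q̄_{C̃})`. -/
def psiDown2 : ExtKLR 𝕜 N C t (mTot N lam + 2) :=
  ((List.range (mTot N lam)).reverse.map (Pn 𝕜 N C t (mTot N lam + 2))).prod

/-- `ψ_{m+1} ψ_m ⋯ ψ_2` in `R_{m+2}(Q̄_{C̃})`. -/
def psiDown2' : ExtKLR 𝕜 N C t (mTot N lam + 2) :=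
  ((List.range (mTot N lam)).reverse.map
    (fun l => Pn 𝕜 N C t (mTot N lam + 2) (l + 1))).prod

end MiddleThick

/-! ### Strand relations in an abstract algebra -/

/-- The local relations, on `n` strands labelled by `Ĩ`, needed to pull a pair of strands labelled
in `I` through strands labelled in `Ī`. -/
structure StrandRelations {A : Type} [Ring A] {N : ℕ} (n : ℕ) (X P : ℕ → A)
    (e : (ℕ → Fin N ⊕ Fin N) → A) : Prop where
  x_comm : ∀ a b, X a * X b = X b * X a
  x_idem : ∀ k w, X k * e w = e w * X k
  psi_comm : ∀ {l k}, l + 1 < k → P l * P k = P k * P l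
  psi_idem : ∀ {l} w, l + 1 < n → P l * e w = e (w ∘ Equiv.swap l (l + 1)) * P l
  psi_x : ∀ {l k}, l + 1 < n → k ≠ l → k ≠ l + 1 → P l * X k = X k * P l
  psi_x_right : ∀ {l w}, l + 1 < n → w l ≠ w (l + 1) →
    P l * X (l + 1) * e w = X l * P l * e w
  psi_x_left : ∀ {l w}, l + 1 < n → w l ≠ w (l + 1) →
    P l * X l * e w = X (l + 1) * P l * e w
  psi_sq_left : ∀ {l w i k}, l + 1 < n → w l = Sum.inl i → w (l + 1) = Sum.inr k →
    P l * P l * e w = (if k = i then X l - X (l + 1) else 1) * e w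
  psi_sq_right : ∀ {l w i k}, l + 1 < n → w l = Sum.inr k → w (l + 1) = Sum.inl i →
    P l * P l * e w = (if k = i then X (l + 1) - X l else 1) * e w
  braid : ∀ {l w i k j}, l + 2 < n → w l = Sum.inl i → w (l + 1) = Sum.inr k →
    w (l + 2) = Sum.inl j →
    P l * P (l + 1) * P l * e w
      = P (l + 1) * P l * P (l + 1) * e w + if i = j ∧ k = i then e w else 0

/-- The ascending product `P d * P (d + 1) * ⋯ * P (d + m - 1)`. -/
def ascProd {A : Type} [Ring A] (P : ℕ → A) (d m : ℕ) : A :=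
  ((List.range m).map fun l => P (d + l)).prod

/-- The descending product `P (d + m - 1) * ⋯ * P (d + 1) * P d`. -/
def descProd {A : Type} [Ring A] (P : ℕ → A) (d m : ℕ) : A :=
  ((List.range m).reverse.map fun l => P (d + l)).prod

section Products

variable {A : Type} [Ring A] (P : ℕ → A) (d m : ℕ)

@[simp] lemma ascProd_zero : ascProd P d 0 = 1 := by simp [ascProd]

@[simp] lemma descProd_zero : descProd P d 0 = 1 := by simp [descProd]

lemma ascProd_succ : ascProd P d (m + 1) = ascProd P d m * P (d + m) := by
  simp [ascProd, List.range_succ]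

lemma descProd_succ : descProd P d (m + 1) = P (d + m) * descProd P d m := by
  simp [descProd, List.range_succ]

lemma ascProd_succ' : ascProd P d (m + 1) = P d * ascProd P (d + 1) m := by
  simp only [ascProd, List.range_succ_eq_map, List.map_cons, List.prod_cons, List.map_map, add_zero]
  congr 3
  ext l
  simp [Nat.add_comm, Nat.add_left_comm]

lemma descProd_succ' : descProd P d (m + 1) = descProd P (d + 1) m * P d := by
  simp only [descProd, List.range_succ_eq_map, List.reverse_cons, List.map_append, List.map_cons,
    List.map_nil, List.prod_append, List.prod_singleton, add_zero, ← List.map_reverse,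
    List.map_map]
  congr 3
  ext l
  simp [Nat.add_comm, Nat.add_left_comm]

end Products

open scoped IsMulCommutative in
/-- The algebra homomorphism from polynomials determined by a family of commuting elements of a
possibly noncommutative algebra. -/
def commAeval {A : Type} [Ring A] (𝕜 : Type) [Field 𝕜] [Algebra 𝕜 A] (X : ℕ → A)
    (hX : ∀ a b, X a * X b = X b * X a) : MvPolynomial ℕ 𝕜 →ₐ[𝕜] A :=
  have : IsMulCommutative (Algebra.adjoin 𝕜 (Set.range X)) :=
    Algebra.isMulCommutative_adjoin 𝕜 (by rintro _ ⟨a, rfl⟩ _ ⟨b, rfl⟩; exact hX a b)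
  (Algebra.adjoin 𝕜 (Set.range X)).val.comp
    (MvPolynomial.aeval fun l => ⟨X l, Algebra.subset_adjoin ⟨l, rfl⟩⟩)

lemma commAeval_X {A : Type} [Ring A] (𝕜 : Type) [Field 𝕜] [Algebra 𝕜 A] (X : ℕ → A)
    (hX : ∀ a b, X a * X b = X b * X a) (l : ℕ) :
    commAeval 𝕜 X hX (MvPolynomial.X l) = X l := by
  simp [commAeval]

/-- The factor contributed by a strand labelled `k̄` at position `l` to the square of its crossing
with a strand labelled `i` at position `y`. -/
def crossFactor (𝕜 : Type) [Field 𝕜] {N : ℕ} (b : ℕ → Fin N) (i : Fin N) (y l : ℕ) :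
    MvPolynomial ℕ 𝕜 :=
  if b l = i then MvPolynomial.X y - MvPolynomial.X l else 1

lemma rename_crossFactor (𝕜 : Type) [Field 𝕜] {N : ℕ} {b b' : ℕ → Fin N} (i : Fin N)
    (σ : ℕ → ℕ) {y l y' l' : ℕ} (hy : σ y = y') (hl : σ l = l') (hb : b l = b' l') :
    MvPolynomial.rename σ (crossFactor 𝕜 b i y l) = crossFactor 𝕜 b' i y' l' := by
  unfold crossFactor
  split_ifs <;> simp_all

namespace StrandRelations

variable {A : Type} [Ring A] {𝕜 : Type} [Field 𝕜] [Algebra 𝕜 A] {N n : ℕ} {X P : ℕ → A}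
  {e : (ℕ → Fin N ⊕ Fin N) → A}

lemma psi_x_idem (h : StrandRelations n X P e) {l : ℕ} {w : ℕ → Fin N ⊕ Fin N} (hl : l + 1 < n)
    (hw : w l ≠ w (l + 1)) (k : ℕ) :
    P l * X k * e w = X (Equiv.swap l (l + 1) k) * P l * e w := by
  rcases eq_or_ne k l with rfl | h1
  · rw [Equiv.swap_apply_left, h.psi_x_left hl hw]
  rcases eq_or_ne k (l + 1) with rfl | h2
  · rw [Equiv.swap_apply_right, h.psi_x_right hl hw]
  rw [Equiv.swap_apply_of_ne_of_ne h1 h2, h.psi_x hl h1 h2]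

/-- Polynomials in the dots slide through a crossing of strands with different labels. -/
lemma psi_commAeval (h : StrandRelations n X P e) {l : ℕ} {w : ℕ → Fin N ⊕ Fin N}
    (hl : l + 1 < n) (hw : w l ≠ w (l + 1)) (p : MvPolynomial ℕ 𝕜) :
    P l * commAeval 𝕜 X h.x_comm p * e w
      = commAeval 𝕜 X h.x_comm (MvPolynomial.rename (Equiv.swap l (l + 1)) p) * P l * e w := by
  induction p using MvPolynomial.induction_on with
  | C c =>
    rw [MvPolynomial.rename_C, ← MvPolynomial.algebraMap_eq, AlgHom.commutes, Algebra.commutes]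
  | add p q hp hq => simp only [map_add, add_mul, mul_add, hp, hq]
  | mul_X p k hp =>
    simp only [map_mul, commAeval_X, MvPolynomial.rename_X]
    calc _ = P l * commAeval 𝕜 X h.x_comm p * e w * X k := by
          simp only [mul_assoc, h.x_idem]
      _ = commAeval 𝕜 X h.x_comm (MvPolynomial.rename (Equiv.swap l (l + 1)) p)
            * (P l * X k * e w) := by
          rw [hp]; simp only [mul_assoc, h.x_idem]
      _ = _ := by rw [h.psi_x_idem hl hw]; simp only [mul_assoc]

/-- A crossing, a polynomial in the dots, and the crossing undone. -/
lemma psi_commAeval_psi (h : StrandRelations n X P e) {l : ℕ} {w : ℕ → Fin N ⊕ Fin N}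
    (hl : l + 1 < n) (hw : w l ≠ w (l + 1)) (p : MvPolynomial ℕ 𝕜) :
    P l * (commAeval 𝕜 X h.x_comm p * e (w ∘ Equiv.swap l (l + 1))) * P l
      = commAeval 𝕜 X h.x_comm (MvPolynomial.rename (Equiv.swap l (l + 1)) p)
        * (P l * P l * e w) := by
  rw [← mul_assoc, h.psi_commAeval hl (by simpa using hw.symm)]
  simp only [mul_assoc, h.psi_idem w hl]

lemma psi_comm_ascProd (h : StrandRelations n X P e) (d m : ℕ) :
    P d * ascProd P (d + 2) m = ascProd P (d + 2) m * P d := by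
  induction m with
  | zero => simp
  | succ m ih =>
    rw [ascProd_succ, ← mul_assoc, ih, mul_assoc, mul_assoc, h.psi_comm (by omega)]

lemma psi_comm_descProd (h : StrandRelations n X P e) (d m : ℕ) :
    P d * descProd P (d + 2) m = descProd P (d + 2) m * P d := by
  induction m with
  | zero => simp
  | succ m ih =>
    rw [descProd_succ, mul_assoc, ← ih, ← mul_assoc, ← mul_assoc, h.psi_comm (by omega)]

/-- The ascending product moves the strand at position `d + m` to position `d`. -/
lemma ascProd_idem (h : StrandRelations n X P e) {d m : ℕ} (hn : d + m < n)
    (w : ℕ → Fin N ⊕ Fin N) :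
    ∃ w', ascProd P d m * e w = e w' * ascProd P d m ∧ w' d = w (d + m) ∧
      ∀ l < d, w' l = w l := by
  induction m generalizing w with
  | zero => exact ⟨w, by simp⟩
  | succ m ih =>
    obtain ⟨w', h1, h2, h3⟩ := ih (by omega) (w ∘ Equiv.swap (d + m) (d + m + 1))
    refine ⟨w', ?_, ?_, fun l hl => ?_⟩
    · rw [ascProd_succ, mul_assoc, h.psi_idem w (by omega), ← mul_assoc, h1, mul_assoc]
    · rw [h2]; simp [add_assoc]
    · rw [h3 l hl, Function.comp_apply, Equiv.swap_apply_of_ne_of_ne (by omega) (by omega)]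

/-- Pulling a strand labelled `j` to the left through strands labelled in `Ī` and back. -/
lemma descProd_ascProd (h : StrandRelations n X P e) {d m : ℕ} (hn : d + m < n)
    (b : ℕ → Fin N) (j : Fin N) {w : ℕ → Fin N ⊕ Fin N}
    (hb : ∀ l, d ≤ l → l < d + m → w l = Sum.inr (b l)) (hj : w (d + m) = Sum.inl j) :
    descProd P d m * ascProd P d m * e w
      = commAeval 𝕜 X h.x_comm (∏ l ∈ Finset.Ico d (d + m), crossFactor 𝕜 b j (d + m) l)
        * e w := by
  induction m generalizing w with
  | zero => simp
  | succ m ih =>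
    have hbm := hb (d + m) (by omega) (by omega)
    have hj' : w (d + m + 1) = Sum.inl j := hj
    have key := ih (by omega) (w := w ∘ Equiv.swap (d + m) (d + m + 1))
      (fun l h1 h2 => by
        rw [Function.comp_apply, Equiv.swap_apply_of_ne_of_ne (by omega) (by omega)]
        exact hb l h1 (by omega))
      (by simpa using hj')
    calc _ = P (d + m) * (descProd P d m * ascProd P d m
              * e (w ∘ Equiv.swap (d + m) (d + m + 1))) * P (d + m) := by
            simp only [ascProd_succ, descProd_succ, mul_assoc, h.psi_idem w (l := d + m) (by omega)]
      _ = _ := by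
        have hr : ∏ l ∈ Finset.Ico d (d + m),
              MvPolynomial.rename (Equiv.swap (d + m) (d + m + 1)) (crossFactor 𝕜 b j (d + m) l)
            = ∏ l ∈ Finset.Ico d (d + m), crossFactor 𝕜 b j (d + m + 1) l :=
          Finset.prod_congr rfl fun l hl => by
            rw [Finset.mem_Ico] at hl
            exact rename_crossFactor 𝕜 j _ (Equiv.swap_apply_left _ _)
              (Equiv.swap_apply_of_ne_of_ne (by omega) (by omega)) rfl
        have hq : (if b (d + m) = j then X (d + m + 1) - X (d + m) else 1)
            = commAeval 𝕜 X h.x_comm (crossFactor 𝕜 b j (d + m + 1) (d + m)) := by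
          unfold crossFactor
          split_ifs <;> simp [commAeval_X]
        rw [key, h.psi_commAeval_psi (by omega) (by simp [hbm, hj']),
          h.psi_sq_right (by omega) hbm hj', ← add_assoc,
          Finset.prod_Ico_succ_top (by omega), map_mul, mul_assoc,
          map_prod (MvPolynomial.rename (R := 𝕜) (Equiv.swap (d + m) (d + m + 1))), hr, hq]

/-- The braid relation for two strands labelled `i`, `j` with `m` strands labelled in `Ī` between
them; the correction term is a divided difference of a product of crossing factors. -/
lemma braid_middle (h : StrandRelations n X P e) {d m : ℕ} (hn : d + m + 1 < n)
    (b : ℕ → Fin N) (i j : Fin N) {w : ℕ → Fin N ⊕ Fin N} (hi : w d = Sum.inl i)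
    (hb : ∀ l, d < l → l < d + m + 1 → w l = Sum.inr (b l))
    (hj : w (d + m + 1) = Sum.inl j) :
    ∃ f : MvPolynomial ℕ 𝕜,
      (MvPolynomial.X d - MvPolynomial.X (d + m + 1)) * f
        = (if i = j then
            ∏ l ∈ Finset.Ico (d + 1) (d + m + 1), crossFactor 𝕜 b i d l
              - ∏ l ∈ Finset.Ico (d + 1) (d + m + 1), crossFactor 𝕜 b i (d + m + 1) l
          else 0) ∧
      ascProd P d m * P (d + m) * descProd P d m * e w
        = descProd P (d + 1) m * P d * ascProd P (d + 1) m * e w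
          + commAeval 𝕜 X h.x_comm f * e w := by
  induction m generalizing d w b with
  | zero => exact ⟨0, by simp⟩
  | succ m ih =>
    have hb1 := hb (d + 1) (by omega) (by omega)
    have hj' : w (d + 2 + m) = Sum.inl j := by rw [← hj]; congr 1; omega
    have hne : w d ≠ w (d + 1) := by simp [hi, hb1]
    obtain ⟨f, hf, hfe⟩ := ih (d := d + 1) (by omega) b
      (w := w ∘ Equiv.swap d (d + 1)) (by simpa using hi)
      (fun l h1 h2 => by
        rw [Function.comp_apply, Equiv.swap_apply_of_ne_of_ne (by omega) (by omega)]
        exact hb l (by omega) (by omega))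
      (by
        rw [Function.comp_apply, Equiv.swap_apply_of_ne_of_ne (by omega) (by omega), ← hj]
        congr 1; omega)
    obtain ⟨w', hw1, hw2, hw3⟩ := h.ascProd_idem (d := d + 2) (m := m) (by omega) w
    have hbraid := h.braid (l := d) (w := w') (i := i) (k := b (d + 1)) (j := j) (by omega)
      (by rw [hw3 d (by omega), hi]) (by rw [hw3 (d + 1) (by omega), hb1]) (by rw [hw2, hj'])
    have hsq := h.psi_sq_left (l := d) (w := w) (by omega) hi hb1
    have hda := h.descProd_ascProd (𝕜 := 𝕜) (d := d + 2) (m := m) (by omega) b j (w := w)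
      (fun l h1 h2 => hb l (by omega) (by omega)) hj'
    refine ⟨MvPolynomial.rename (Equiv.swap d (d + 1)) f * crossFactor 𝕜 b i d (d + 1)
      + if i = j ∧ b (d + 1) = i then
          ∏ l ∈ Finset.Ico (d + 2) (d + 2 + m), crossFactor 𝕜 b j (d + 2 + m) l else 0, ?_, ?_⟩
    · have hf' := congrArg (MvPolynomial.rename (Equiv.swap d (d + 1))) hf
      have e1 : d + 1 + m + 1 = d + 2 + m := by omega
      have e2 : d + (m + 1) + 1 = d + 2 + m := by omega
      have e3 : d + 1 + 1 = d + 2 := by omega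
      rw [e1, e3] at hf'
      have hbot : ∀ y, ∏ l ∈ Finset.Ico (d + 1) (d + 2 + m), crossFactor 𝕜 b i y l
          = crossFactor 𝕜 b i y (d + 1)
            * ∏ l ∈ Finset.Ico (d + 2) (d + 2 + m), crossFactor 𝕜 b i y l :=
        fun y => Finset.prod_eq_prod_Ico_succ_bot (by omega) _
      rw [e2, hbot, hbot]
      simp only [map_mul, map_sub, MvPolynomial.rename_X, Equiv.swap_apply_right,
        apply_ite (MvPolynomial.rename (R := 𝕜) (Equiv.swap d (d + 1))), map_prod, map_zero] at hf'
      rw [Equiv.swap_apply_of_ne_of_ne (by omega) (by omega)] at hf'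
      have hr : ∀ y y', Equiv.swap d (d + 1) y = y' →
          ∏ l ∈ Finset.Ico (d + 2) (d + 2 + m),
            MvPolynomial.rename (Equiv.swap d (d + 1)) (crossFactor 𝕜 b i y l)
          = ∏ l ∈ Finset.Ico (d + 2) (d + 2 + m), crossFactor 𝕜 b i y' l := by
        intro y y' hy
        refine Finset.prod_congr rfl fun l hl => ?_
        rw [Finset.mem_Ico] at hl
        exact rename_crossFactor 𝕜 i _ hy
          (Equiv.swap_apply_of_ne_of_ne (by omega) (by omega)) rfl
      rw [hr (d + 1) d (by simp),
        hr (d + 2 + m) (d + 2 + m) (Equiv.swap_apply_of_ne_of_ne (by omega) (by omega))] at hf'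
      rw [mul_add, ← mul_assoc, hf']
      by_cases hij : i = j
      · subst hij
        by_cases hbi : b (d + 1) = i
        · simp only [hbi, crossFactor, if_true, and_self]; ring
        · simp [hbi, crossFactor]
      · simp [hij]
    · have hT : ascProd P d (m + 1) * P (d + (m + 1)) * descProd P d (m + 1) * e w
          = P d * (ascProd P (d + 1) m * P (d + 1 + m) * descProd P (d + 1) m
              * e (w ∘ Equiv.swap d (d + 1))) * P d := by
        rw [ascProd_succ', descProd_succ', show d + (m + 1) = d + 1 + m by omega]
        simp only [mul_assoc, h.psi_idem w (l := d) (by omega)]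
      have hB : P d * (descProd P (d + 2) m * P (d + 1) * ascProd P (d + 2) m
            * e (w ∘ Equiv.swap d (d + 1))) * P d
          = descProd P (d + 2) m * (P d * P (d + 1) * P d * e w') * ascProd P (d + 2) m := by
        calc _ = P d * descProd P (d + 2) m * P (d + 1) * (ascProd P (d + 2) m * P d) * e w := by
              simp only [mul_assoc, h.psi_idem w (l := d) (by omega)]
          _ = descProd P (d + 2) m * P d * P (d + 1) * P d * (ascProd P (d + 2) m * e w) := by
              rw [h.psi_comm_descProd, ← h.psi_comm_ascProd]; simp only [mul_assoc]
          _ = _ := by rw [hw1]; simp only [mul_assoc]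
      have hC : descProd P (d + 2) m * (P (d + 1) * P d * P (d + 1) * e w') * ascProd P (d + 2) m
          = descProd P (d + 1) (m + 1) * P d * ascProd P (d + 1) (m + 1) * e w := by
        rw [ascProd_succ', descProd_succ']
        simp only [mul_assoc, hw1]
      have hD : descProd P (d + 2) m * e w' * ascProd P (d + 2) m
          = descProd P (d + 2) m * ascProd P (d + 2) m * e w := by
        simp only [mul_assoc, hw1]
      have hsq' : P d * P d * e w
          = commAeval 𝕜 X h.x_comm (crossFactor 𝕜 b i d (d + 1)) * e w := by
        rw [hsq]; unfold crossFactor; split_ifs <;> simp [commAeval_X]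
      rw [hT, hfe, mul_add, add_mul, h.psi_commAeval_psi (by omega) hne, hsq', hB, hbraid, mul_add,
        add_mul, hC, map_add, map_mul]
      by_cases hc : i = j ∧ b (d + 1) = i
      · rw [if_pos hc, if_pos hc, hD, hda]
        simp only [add_mul, mul_assoc]; abel
      · rw [if_neg hc, if_neg hc]
        simp only [mul_assoc, map_zero, mul_zero, zero_mul, add_zero]

end StrandRelations

/-! ### The divided difference in terms of elementary symmetric polynomials -/

/-- The divided difference of `∏ l ∈ S, (u - r l)`, expanded in elementary symmetric polynomials. -/
lemma sub_mul_sum_esymm {R : Type} [CommRing R] (r : ℕ → R) (S : Finset ℕ) (x y : R) :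
    (x - y) * ∑ a ∈ Finset.range S.card, ∑ c ∈ Finset.range (S.card - a),
        (-1) ^ c * (x ^ a * y ^ (S.card - 1 - a - c) * ∑ T ∈ S.powersetCard c, ∏ l ∈ T, r l)
      = ∏ l ∈ S, (x - r l) - ∏ l ∈ S, (y - r l) := by
  have hprod (u : R) : ∏ l ∈ S, (u - r l) = ∑ c ∈ Finset.range (S.card + 1),
      (-1) ^ c * (∑ T ∈ S.powersetCard c, ∏ l ∈ T, r l) * u ^ (S.card - c) := by
    simp only [sub_eq_neg_add]
    rw [Finset.prod_add, Finset.sum_powerset]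
    refine Finset.sum_congr rfl fun c hc => ?_
    rw [Finset.mul_sum, Finset.sum_mul]
    refine Finset.sum_congr rfl fun T hT => ?_
    obtain ⟨hTS, hTc⟩ := Finset.mem_powersetCard.1 hT
    rw [Finset.prod_neg, Finset.prod_const, Finset.card_sdiff_of_subset hTS, hTc]
  rw [hprod, hprod, ← Finset.sum_sub_distrib, Finset.sum_range_succ]
  simp only [Nat.sub_self, pow_zero, sub_self, add_zero]
  have hswap : ∑ a ∈ Finset.range S.card, ∑ c ∈ Finset.range (S.card - a),
        (-1) ^ c * (x ^ a * y ^ (S.card - 1 - a - c) * ∑ T ∈ S.powersetCard c, ∏ l ∈ T, r l)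
      = ∑ c ∈ Finset.range S.card, ∑ a ∈ Finset.range (S.card - c),
        (-1) ^ c * (x ^ a * y ^ (S.card - 1 - a - c) * ∑ T ∈ S.powersetCard c, ∏ l ∈ T, r l) :=
    Finset.sum_comm' fun a c => by simp only [Finset.mem_range]; omega
  rw [hswap, Finset.mul_sum]
  refine Finset.sum_congr rfl fun c _ => ?_
  generalize ∑ T ∈ S.powersetCard c, ∏ l ∈ T, r l = s
  rw [← mul_sub, ← (Commute.all x y).mul_geom_sum₂, mul_left_comm, Finset.mul_sum, Finset.mul_sum,
    Finset.mul_sum]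
  refine Finset.sum_congr rfl fun a _ => ?_
  rw [show S.card - 1 - a - c = S.card - c - 1 - a by omega]
  ring

/-! ### Positions of the blocks -/

lemma blockList_eq_append (N : ℕ) (lam : Fin N → ℕ) (i : Fin N) :
    ∃ L₁ L₂ : List (Fin N), blockList N lam = L₁ ++ List.replicate (lam i) i ++ L₂ ∧
      L₁.length = psum N lam i ∧ i ∉ L₁ ∧ i ∉ L₂ := by
  have hsplit : List.finRange N
      = (List.finRange N).take i ++ i :: (List.finRange N).drop (i + 1) := by
    conv_lhs => rw [← List.take_append_drop i (List.finRange N)]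
    rw [List.drop_eq_getElem_cons (by simp)]
    simp
  have hmem : ∀ a : Fin N, a ∈ (List.finRange N).take i ↔ a < i := by
    intro a
    simp only [List.mem_take_iff_getElem, List.getElem_finRange]
    constructor
    · rintro ⟨k, hk, rfl⟩
      simp at hk ⊢
      exact hk
    · intro ha
      exact ⟨a, by simpa using ha, by simp⟩
  have hnd : (List.finRange N).Nodup := List.nodup_finRange N
  have hnotin : i ∉ (List.finRange N).drop (i + 1) := by
    rw [hsplit, List.nodup_append] at hnd
    exact (List.nodup_cons.1 hnd.2.1).1
  refine ⟨((List.finRange N).take i).flatMap fun k => List.replicate (lam k) k,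
    ((List.finRange N).drop (i + 1)).flatMap fun k => List.replicate (lam k) k, ?_, ?_, ?_, ?_⟩
  · unfold blockList
    conv_lhs => rw [hsplit]
    simp
  · rw [List.length_flatMap, psum, ← Finset.sum_filter]
    simp only [List.length_replicate]
    rw [← List.sum_toFinset _ (List.Nodup.sublist (List.take_sublist _ _) hnd)]
    refine Finset.sum_congr ?_ fun _ _ => rfl
    ext a
    simp [hmem]
  · simp [List.mem_flatMap, List.mem_replicate, hmem]
  · intro hi
    obtain ⟨a, ha, hi⟩ := List.mem_flatMap.1 hi
    obtain rfl := (List.mem_replicate.1 hi).2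
    exact hnotin ha

lemma psum_add_le_mTot (N : ℕ) (lam : Fin N → ℕ) (i : Fin N) :
    psum N lam i + lam i ≤ mTot N lam := by
  obtain ⟨L₁, L₂, h, hl, -, -⟩ := blockList_eq_append N lam i
  simp only [mTot, h, List.length_append, List.length_replicate, hl]
  omega

lemma blockOf_eq_iff (N : ℕ) (lam : Fin N → ℕ) (i : Fin N) (l : Fin (mTot N lam)) :
    blockOf N lam l = i ↔ psum N lam i ≤ l ∧ (l : ℕ) < psum N lam i + lam i := by
  obtain ⟨L₁, L₂, h, hl, h1, h2⟩ := blockList_eq_append N lam i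
  have hlt : (l : ℕ) < (L₁ ++ List.replicate (lam i) i ++ L₂).length := by
    rw [← h]; exact l.2
  have hget : blockOf N lam l = (L₁ ++ List.replicate (lam i) i ++ L₂)[(l : ℕ)] :=
    List.getElem_of_eq h l.2
  rw [hget, ← hl]
  by_cases ha : (l : ℕ) < L₁.length
  · rw [List.getElem_append_left (by simp; omega), List.getElem_append_left ha]
    refine iff_of_false (fun hc => h1 (hc ▸ List.getElem_mem ha)) (by omega)
  by_cases hb : (l : ℕ) < L₁.length + lam i
  · rw [List.getElem_append_left (by simpa using hb), List.getElem_append_right (by omega),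
      List.getElem_replicate]
    exact iff_of_true rfl ⟨by omega, hb⟩
  · rw [List.getElem_append_right (by simp; omega)]
    refine iff_of_false (fun hc => h2 (hc ▸ List.getElem_mem _)) (by omega)

/-! ### The extended KLR algebra -/

section Ext

variable {𝕜 : Type} [Field 𝕜] {N : ℕ} {C : CartanDatum (Fin N)}
  {t : Fin N ⊕ Fin N → Fin N ⊕ Fin N → 𝕜} {n : ℕ}

lemma klrMk_rel {a b : FreeAlgebra 𝕜 (KLRGen (Fin N ⊕ Fin N) n)}
    (h : KLRRel 𝕜 (Fin N ⊕ Fin N) n (extForm C) t (fun _ => 1) (fun _ _ _ _ => 0) a b) :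
    klrMk 𝕜 (Fin N ⊕ Fin N) n (extForm C) t (fun _ => 1) (fun _ _ _ _ => 0) a
      = klrMk 𝕜 (Fin N ⊕ Fin N) n (extForm C) t (fun _ => 1) (fun _ _ _ _ => 0) b :=
  RingQuot.mkAlgHom_rel 𝕜 h

lemma half_form_ne_zero (C : CartanDatum (Fin N)) (i : Fin N) : C.form i i / 2 ≠ 0 := by
  have h1 := C.diag_pos i
  obtain ⟨k, hk⟩ := C.diag_even i
  omega

lemma two_mul_neg_half_form_div (C : CartanDatum (Fin N)) (i : Fin N) :
    2 * -(C.form i i / 2) / C.form i i = -1 := by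
  have h1 := C.diag_pos i
  obtain ⟨k, hk⟩ := C.diag_even i
  have h2 : 2 * -(C.form i i / 2) = -C.form i i := by omega
  rw [h2, Int.neg_ediv_of_dvd dvd_rfl, Int.ediv_self h1.ne']

lemma psiSqS_zero (a b : Fin N ⊕ Fin N) (k l : Fin n) :
    psiSqS 𝕜 (Fin N ⊕ Fin N) n (extForm C) (fun _ _ _ _ => 0) a b k l = 0 := by
  simp [psiSqS]

end Ext

lemma strandRelations_extKLR (𝕜 : Type) [Field 𝕜] (N : ℕ) (C : CartanDatum (Fin N))
    (t : Fin N ⊕ Fin N → Fin N ⊕ Fin N → 𝕜)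
    (ht1 : ∀ k : Fin N, t (Sum.inr k) (Sum.inl k) = -1)
    (ht2 : ∀ k : Fin N, t (Sum.inl k) (Sum.inr k) = 1)
    (ht3 : ∀ a b, extForm C a b = 0 → t a b = 1) (n : ℕ) :
    StrandRelations n (Xn 𝕜 N C t n) (Pn 𝕜 N C t n) (fun w => eS 𝕜 N C t n fun l => w l) where
  x_comm a b := by
    unfold Xn
    split_ifs with h1 h2 h2
    · simpa only [xQ, map_mul] using klrMk_rel (C := C) (t := t) (.xx ⟨a, h1⟩ ⟨b, h2⟩)
    all_goals simp
  x_idem k w := by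
    unfold Xn
    split_ifs with h1
    · simpa only [xQ, eS, eQ, map_mul] using klrMk_rel (C := C) (t := t) (.xe ⟨k, h1⟩ _)
    · simp
  psi_comm {l k} h := by
    unfold Pn
    split_ifs with h1 h2 h2
    · simpa only [pQ, map_mul] using klrMk_rel (C := C) (t := t) (.psipsi ⟨l, h1⟩ ⟨k, h2⟩ h)
    all_goals simp
  psi_idem {l} w h := by
    have h1 : l < n - 1 := by omega
    have := klrMk_rel (C := C) (t := t) (.psie ⟨l, h1⟩ fun l => w l)
    rw [map_mul, map_mul] at this
    simp only [Pn, h1, dif_pos, pQ, eS, eQ]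
    convert this using 4
    funext k
    simp only [Function.comp_apply, Equiv.swap_apply_def, lpos, rpos, Fin.ext_iff]
    split_ifs <;> simp_all
  psi_x {l k} h hk1 hk2 := by
    have h1 : l < n - 1 := by omega
    simp only [Pn, h1, dif_pos, Xn]
    split_ifs with h2
    · simpa only [pQ, xQ, map_mul] using klrMk_rel (C := C) (t := t)
        (.psix ⟨l, h1⟩ ⟨k, h2⟩ (by simpa [lpos, Fin.ext_iff] using hk1)
          (by simpa [rpos, Fin.ext_iff] using hk2))
    · simp
  psi_x_right {l w} h hw := by
    have h1 : l < n - 1 := by omega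
    have := klrMk_rel (C := C) (t := t) (.dot1 ⟨l, h1⟩ fun l => w l)
    rw [if_neg (by simpa [lpos, rpos] using hw), map_zero, map_sub, sub_eq_zero] at this
    simp only [map_mul] at this
    have h2 : l < n := by omega
    simp only [Pn, h1, dif_pos, Xn, h, h2]
    exact this.symm
  psi_x_left {l w} h hw := by
    have h1 : l < n - 1 := by omega
    have := klrMk_rel (C := C) (t := t) (.dot2 ⟨l, h1⟩ fun l => w l)
    rw [if_neg (by simpa [lpos, rpos] using hw), map_zero, map_sub, sub_eq_zero] at this
    simp only [map_mul] at this
    have h2 : l < n := by omega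
    simp only [Pn, h1, dif_pos, Xn, h, h2]
    exact this
  psi_sq_left {l w i k} h hi hk := by
    have h1 : l < n - 1 := by omega
    have h2 : l < n := by omega
    have := klrMk_rel (C := C) (t := t) (.psisq ⟨l, h1⟩ fun l => w l)
    simp only [Pn, h1, dif_pos, Xn, h, h2]
    have e1 : w (lpos (⟨l, h1⟩ : Fin (n - 1)) : Fin n) = Sum.inl i := hi
    have e2 : w (rpos (⟨l, h1⟩ : Fin (n - 1)) : Fin n) = Sum.inr k := hk
    simp only [e1, e2, reduceCtorEq, if_false, psiSqS_zero] at this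
    by_cases hki : k = i
    · subst hki
      simp only [extForm, if_true, neg_eq_zero, half_form_ne_zero, if_false, cB, ht1, ht2,
        two_mul_neg_half_form_div, neg_neg, Int.toNat_one, pow_one, one_smul, neg_smul, add_zero,
        ← sub_eq_add_neg, map_mul, map_sub] at this ⊢
      exact this
    · have h0 : extForm C (Sum.inl i) (Sum.inr k) = 0 := by simp [extForm, hki]
      simp only [h0, if_true, ht3 _ _ h0, one_smul, map_mul] at this
      rw [if_neg hki, one_mul]
      exact this
  psi_sq_right {l w i k} h hk hi := by
    have h1 : l < n - 1 := by omega
    have h2 : l < n := by omega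
    have := klrMk_rel (C := C) (t := t) (.psisq ⟨l, h1⟩ fun l => w l)
    simp only [Pn, h1, dif_pos, Xn, h, h2]
    have e1 : w (lpos (⟨l, h1⟩ : Fin (n - 1)) : Fin n) = Sum.inr k := hk
    have e2 : w (rpos (⟨l, h1⟩ : Fin (n - 1)) : Fin n) = Sum.inl i := hi
    simp only [e1, e2, reduceCtorEq, if_false, psiSqS_zero] at this
    by_cases hki : k = i
    · subst hki
      simp only [extForm, if_true, neg_eq_zero, half_form_ne_zero, if_false, cB, ht1, ht2,
        two_mul_neg_half_form_div, neg_neg, Int.toNat_one, pow_one, one_smul, neg_smul, add_zero,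
        neg_add_eq_sub, map_mul, map_sub] at this ⊢
      exact this
    · have h0 : extForm C (Sum.inr k) (Sum.inl i) = 0 := by simp [extForm, Ne.symm hki]
      simp only [h0, if_true, ht3 _ _ h0, one_smul, map_mul] at this
      rw [if_neg hki, one_mul]
      exact this
  braid {l w i k j} h hi hk hj := by
    have h1 : l < n - 1 := by omega
    have h2 : l + 1 < n - 1 := by omega
    have := klrMk_rel (C := C) (t := t) (.braid ⟨l, h1⟩ ⟨l + 1, h2⟩ rfl fun l => w l)
    simp only [Pn, h1, h2, dif_pos]
    have e1 : w (lpos (⟨l, h1⟩ : Fin (n - 1)) : Fin n) = Sum.inl i := hi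
    have e2 : w (rpos (⟨l, h1⟩ : Fin (n - 1)) : Fin n) = Sum.inr k := hk
    have e3 : w (rpos (⟨l + 1, h2⟩ : Fin (n - 1)) : Fin n) = Sum.inl j := hj
    simp only [e1, e2, e3, map_sub, map_mul, sub_eq_iff_eq_add'] at this
    refine this.trans (congrArg₂ _ rfl ?_)
    by_cases hki : k = i
    · subst hki
      simp only [Sum.inl.injEq, extForm, if_true, cB, two_mul_neg_half_form_div]
      split_ifs with hc <;> simp_all [eS, eQ]
    · simp [cB, extForm, hki]

lemma commAeval_esymm (𝕜 : Type) [Field 𝕜] (N : ℕ) (C : CartanDatum (Fin N))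
    (t : Fin N ⊕ Fin N → Fin N ⊕ Fin N → 𝕜) (n c : ℕ) (S : Finset ℕ)
    (hX : ∀ a b, Xn 𝕜 N C t n a * Xn 𝕜 N C t n b = Xn 𝕜 N C t n b * Xn 𝕜 N C t n a) :
    commAeval 𝕜 (Xn 𝕜 N C t n) hX (∑ T ∈ S.powersetCard c, ∏ l ∈ T, MvPolynomial.X l)
      = esymAt 𝕜 N C t n c S := by
  rw [map_sum, esymAt]
  refine Finset.sum_congr rfl fun T _ => ?_
  have : ∏ l ∈ T, (MvPolynomial.X l : MvPolynomial ℕ 𝕜)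
      = ((T.sort (· ≤ ·)).map MvPolynomial.X).prod := by
    rw [← List.prod_toFinset _ (T.sort_nodup _), Finset.sort_toFinset]
  rw [this, map_list_prod, List.map_map]
  congr 2
  ext l
  exact commAeval_X 𝕜 _ hX l

/-- braid relation with the thick strand in the middle, in
`R_{m+2}(Q̄_{C̃})`:
`(ψ_1⋯ψ_m) ψ_{m+1} (ψ_m⋯ψ_1) E'' − (ψ_{m+1}⋯ψ_2) ψ_1 (ψ_2⋯ψ_{m+1}) E''
  = δ_{i,j} Σ_{a+b+c=λ_k^{(i)}−1} (−1)^c x_1^a x_{m+2}^b E_c^{(i)}[2,…,m+1] E''`. -/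
theorem braid_with_thick_strand_in_middle
    (𝕜 : Type) [Field 𝕜] (N : ℕ) (C : CartanDatum (Fin N))
    (t : Fin N ⊕ Fin N → Fin N ⊕ Fin N → 𝕜)
    (ht0 : ∀ a b, t a b ≠ 0)
    (ht1 : ∀ k : Fin N, t (Sum.inr k) (Sum.inl k) = -1)
    (ht2 : ∀ k : Fin N, t (Sum.inl k) (Sum.inr k) = 1)
    (ht3 : ∀ a b, extForm C a b = 0 → t a b = 1)
    (ht4 : ∀ a, t a a = 1)
    (lam : Fin N → ℕ) (i j : Fin N) :
    psiUp2 𝕜 N C t lam * Pn 𝕜 N C t (mTot N lam + 2) (mTot N lam)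
        * psiDown2 𝕜 N C t lam * Emid 𝕜 N C t lam i j
      - psiDown2' 𝕜 N C t lam * Pn 𝕜 N C t (mTot N lam + 2) 0
        * psiUp2' 𝕜 N C t lam * Emid 𝕜 N C t lam i j
      = if i = j then
          ∑ a ∈ Finset.range (lam i), ∑ c ∈ Finset.range (lam i - a),
            ((-1 : 𝕜) ^ c) •
              (Xn 𝕜 N C t (mTot N lam + 2) 0 ^ a
                * Xn 𝕜 N C t (mTot N lam + 2) (mTot N lam + 1) ^ (lam i - 1 - a - c)
                * esymAt 𝕜 N C t (mTot N lam + 2) c (blkSet N lam 1 i)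
                * Emid 𝕜 N C t lam i j)
        else 0 := by
  set m := mTot N lam with hm
  have h := strandRelations_extKLR 𝕜 N C t ht1 ht2 ht3 (m + 2)
  set v : Fin (m + 2) → Fin N ⊕ Fin N :=
    Fin.snoc (Fin.cons (Sum.inl i) (mubar N lam)) (Sum.inl j) with hv
  set w : ℕ → Fin N ⊕ Fin N := fun l => if hl : l < m + 2 then v ⟨l, hl⟩ else Sum.inl i with hw
  set b : ℕ → Fin N := fun l => if hl : l - 1 < m then blockOf N lam ⟨l - 1, hl⟩ else i with hb
  have hwv : (fun l : Fin (m + 2) => w l) = v := by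
    funext l
    simp [hw]
  have hwi : w 0 = Sum.inl i := by
    simp only [hw, hv]
    rw [dif_pos (by omega)]
    exact Fin.snoc_castSucc (α := fun _ => Fin N ⊕ Fin N) (Sum.inl j)
      (Fin.cons (Sum.inl i) (mubar N lam)) 0
  have hwj : w (0 + m + 1) = Sum.inl j := by
    simp only [hw, hv, zero_add]
    rw [dif_pos (by omega)]
    exact Fin.snoc_last (α := fun _ => Fin N ⊕ Fin N) (Sum.inl j)
      (Fin.cons (Sum.inl i) (mubar N lam))
  have hwb : ∀ l, 0 < l → l < 0 + m + 1 → w l = Sum.inr (b l) := by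
    intro l hl1 hl2
    obtain ⟨l, rfl⟩ := Nat.exists_eq_add_of_lt hl1
    have hl : l < m := by omega
    simp only [hw, hv, hb, zero_add]
    rw [dif_pos (by omega), dif_pos (by simpa using hl)]
    exact Fin.snoc_castSucc (α := fun _ => Fin N ⊕ Fin N) (Sum.inl j)
      (Fin.cons (Sum.inl i) (mubar N lam)) (Fin.succ ⟨l, hl⟩)
  have hS : (Finset.Ico 1 (m + 1)).filter (fun l => b l = i) = blkSet N lam 1 i := by
    ext l
    have hle := psum_add_le_mTot N lam i
    simp only [Finset.mem_filter, Finset.mem_Ico, blkSet, hb]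
    by_cases hl : l - 1 < m
    · rw [dif_pos hl, blockOf_eq_iff]
      simp only
      omega
    · rw [dif_neg hl]
      omega
  obtain ⟨f, hf, hfe⟩ := h.braid_middle (𝕜 := 𝕜) (d := 0) (m := m) (by omega) b i j hwi hwb hwj
  have hcard : (blkSet N lam 1 i).card = lam i := by simp [blkSet]
  have hne : (MvPolynomial.X 0 - MvPolynomial.X (m + 1) : MvPolynomial ℕ 𝕜) ≠ 0 :=
    sub_ne_zero.2 fun hc => by simpa using MvPolynomial.X_injective hc
  have hcross (y : ℕ) : ∏ l ∈ Finset.Ico 1 (m + 1), crossFactor 𝕜 b i y l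
      = ∏ l ∈ blkSet N lam 1 i, (MvPolynomial.X y - MvPolynomial.X l) := by
    rw [← hS, Finset.prod_filter]
    rfl
  have hf' : f = if i = j then ∑ a ∈ Finset.range (lam i), ∑ c ∈ Finset.range (lam i - a),
      (-1) ^ c * (MvPolynomial.X 0 ^ a * MvPolynomial.X (m + 1) ^ (lam i - 1 - a - c)
        * ∑ T ∈ (blkSet N lam 1 i).powersetCard c, ∏ l ∈ T, MvPolynomial.X l) else 0 := by
    refine mul_left_cancel₀ hne ?_
    simp only [zero_add] at hf
    rw [hf, hcross, hcross, ← sub_mul_sum_esymm, hcard, mul_ite, mul_zero]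
  have hup : psiUp2 𝕜 N C t lam = ascProd (Pn 𝕜 N C t (m + 2)) 0 m := by
    simp only [psiUp2, ascProd, zero_add]; rfl
  have hdown : psiDown2 𝕜 N C t lam = descProd (Pn 𝕜 N C t (m + 2)) 0 m := by
    simp only [psiDown2, descProd, zero_add]; rfl
  have hup' : psiUp2' 𝕜 N C t lam = ascProd (Pn 𝕜 N C t (m + 2)) (0 + 1) m := by
    simp only [psiUp2', ascProd, zero_add, Nat.add_comm 1]; rfl
  have hdown' : psiDown2' 𝕜 N C t lam = descProd (Pn 𝕜 N C t (m + 2)) (0 + 1) m := by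
    simp only [psiDown2', descProd, zero_add, Nat.add_comm 1]; rfl
  have hE : Emid 𝕜 N C t lam i j
      = eS 𝕜 N C t (m + 2) (fun l => w l) * nilProd 𝕜 N C t lam (m + 2) 1 := by
    rw [hwv]
    rfl
  rw [zero_add] at hfe
  rw [hup, hdown, hup', hdown', hE, ← mul_assoc, ← mul_assoc, hfe, add_mul, add_sub_cancel_left,
    mul_assoc, hf']
  split_ifs with hij
  · simp only [map_sum, map_mul, map_pow, map_neg, map_one, commAeval_X, Finset.sum_mul]
    refine Finset.sum_congr rfl fun a _ => Finset.sum_congr rfl fun c _ => ?_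
    rw [← commAeval_esymm 𝕜 N C t (m + 2) c _ h.x_comm, Algebra.smul_def]
    simp only [map_sum, map_pow, map_neg, map_one, mul_assoc]
    rfl
  · rw [map_zero, zero_mul]

end
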